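/- Let a = (a_1,…,a_r) be a degree sequence and let I ⊆ A = K[x_1,…,x_n] be a homogeneous ideal containing the pure-powers ideal 𝔞 = (x_1^{a_1},…,x_r^{a_r}). Then there exists an a-spp (strongly-stable-plus-powers) ideal with the same Hilbert function as I. -/

import Mathlib

open MvPolynomial

section Defs

variable {K : Type*} [Field K]

/-- Total degree of an exponent vector. -/
def expDeg {n : ℕ} (m : Fin n →₀ ℕ) : ℕ := ∑ i, m i

/-- `lexLe m m'` means `m ≤ m'` in the lexicographic order with `x_1 > x_2 > … > x_n`. -/
def lexLe {n : ℕ} (m m' : Fin n →₀ ℕ) : Prop :=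
  m = m' ∨ ∃ i : Fin n, (∀ j : Fin n, j < i → m j = m' j) ∧ m i < m' i

/-- A lex-segment in degree `d`: an upward (w.r.t. lex) closed set of degree-`d`
exponent vectors. -/
def IsLexSegment (n d : ℕ) (S : Set (Fin n →₀ ℕ)) : Prop :=
  (∀ m ∈ S, expDeg m = d) ∧
    ∀ m ∈ S, ∀ m' : Fin n →₀ ℕ, expDeg m' = d → lexLe m m' → m' ∈ S

/-- The pure-powers ideal `(x_1^{a_1}, …, x_r^{a_r})`. -/
noncomputable def purePowers (K : Type*) [Field K] {n r : ℕ} (hrn : r ≤ n)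
    (a : Fin r → ℕ) : Ideal (MvPolynomial (Fin n) K) :=
  Ideal.span (Set.range fun i : Fin r => X (Fin.castLE hrn i) ^ a i)

/-- A homogeneous ideal. -/
def IsHomog {n : ℕ} (I : Ideal (MvPolynomial (Fin n) K)) : Prop :=
  ∀ f ∈ I, ∀ d : ℕ, homogeneousComponent d f ∈ I

/-- The degree-`d` component of an ideal, as a `K`-subspace. -/
noncomputable def component {n : ℕ} (I : Ideal (MvPolynomial (Fin n) K)) (d : ℕ) :
    Submodule K (MvPolynomial (Fin n) K) :=
  Submodule.restrictScalars K I ⊓ homogeneousSubmodule (Fin n) K d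

/-- Hilbert function of an ideal: `dim_K I_d`. -/
noncomputable def hilb {n : ℕ} (I : Ideal (MvPolynomial (Fin n) K)) (d : ℕ) : ℕ :=
  Module.finrank K ↥(component I d)

/-- An `a`-lpp (lex-plus-powers) ideal: a homogeneous (monomial) ideal each of whose graded
components is the span of a lex-segment plus the corresponding component of the
pure-powers ideal. -/
def IsLPP {n r : ℕ} (hrn : r ≤ n) (a : Fin r → ℕ)
    (J : Ideal (MvPolynomial (Fin n) K)) : Prop :=
  IsHomog J ∧
    ∀ d : ℕ, ∃ S : Set (Fin n →₀ ℕ), IsLexSegment n d S ∧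
      component J d =
        Submodule.span K ((fun m => (monomial m (1 : K) : MvPolynomial (Fin n) K)) '' S)
          ⊔ component (purePowers K hrn a) d

/-- `I` satisfies `EGH_a(d)`. -/
def EGHd {n r : ℕ} (hrn : r ≤ n) (a : Fin r → ℕ)
    (I : Ideal (MvPolynomial (Fin n) K)) (d : ℕ) : Prop :=
  ∃ J : Ideal (MvPolynomial (Fin n) K), IsLPP hrn a J ∧
    hilb J d = hilb I d ∧ hilb J (d + 1) ≤ hilb I (d + 1)

/-- `I` satisfies `EGH_a`. -/
def EGH {n r : ℕ} (hrn : r ≤ n) (a : Fin r → ℕ)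
    (I : Ideal (MvPolynomial (Fin n) K)) : Prop :=
  ∀ d : ℕ, EGHd hrn a I d

/-- A monomial ideal. -/
def IsMonomialIdeal {n : ℕ} (I : Ideal (MvPolynomial (Fin n) K)) : Prop :=
  ∃ M : Set (Fin n →₀ ℕ),
    I = Ideal.span ((fun m => (monomial m (1 : K) : MvPolynomial (Fin n) K)) '' M)

/-- A strongly stable (monomial) ideal. -/
def IsStronglyStable {n : ℕ} (S : Ideal (MvPolynomial (Fin n) K)) : Prop :=
  IsMonomialIdeal S ∧
    ∀ (m : Fin n →₀ ℕ) (i j : Fin n), j ≤ i →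
      (monomial (m + Finsupp.single i 1) (1 : K) : MvPolynomial (Fin n) K) ∈ S →
      (monomial (m + Finsupp.single j 1) (1 : K) : MvPolynomial (Fin n) K) ∈ S

/-- An `a`-spp (strongly-stable-plus-powers) ideal. -/
def IsSPP {n r : ℕ} (hrn : r ≤ n) (a : Fin r → ℕ)
    (J : Ideal (MvPolynomial (Fin n) K)) : Prop :=
  ∃ S : Ideal (MvPolynomial (Fin n) K), IsStronglyStable S ∧ J = S ⊔ purePowers K hrn a

/-- A regular sequence: each `f i` is a non-zerodivisor modulo `(f j : j < i)`. -/
def IsRegSeq {n r : ℕ} (f : Fin r → MvPolynomial (Fin n) K) : Prop :=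
  ∀ i : Fin r, ∀ g : MvPolynomial (Fin n) K,
    g * f i ∈ Ideal.span { p | ∃ j : Fin r, j < i ∧ p = f j } →
    g ∈ Ideal.span { p | ∃ j : Fin r, j < i ∧ p = f j }

/-- `I` contains a homogeneous regular sequence of degree `a`. -/
def ContainsRegSeq {n r : ℕ} (a : Fin r → ℕ)
    (I : Ideal (MvPolynomial (Fin n) K)) : Prop :=
  ∃ f : Fin r → MvPolynomial (Fin n) K,
    (∀ i, f i ∈ I) ∧ IsRegSeq f ∧ ∀ i, (f i).IsHomogeneous (a i)

/-- `dim_K (N/P)` for ideals `P ≤ N` (the `K`-dimension of `N/(N ∩ P)`). -/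
noncomputable def quotDim (K : Type*) [Field K] {n : ℕ}
    (N P : Ideal (MvPolynomial (Fin n) K)) : ℕ :=
  Module.finrank K
    (↥(Submodule.restrictScalars K N) ⧸
      Submodule.comap (Submodule.restrictScalars K N).subtype (Submodule.restrictScalars K P))

/-- `dim_K (I/F)_d`. -/
noncomputable def relHilb {n : ℕ} (I F : Ideal (MvPolynomial (Fin n) K)) (d : ℕ) : ℕ :=
  Module.finrank K
    (↥(component I d) ⧸ Submodule.comap (component I d).subtype (Submodule.restrictScalars K F))

/-- `dim_K (A/I)_d`. -/
noncomputable def hilbQ {n : ℕ} (I : Ideal (MvPolynomial (Fin n) K)) (d : ℕ) : ℕ :=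
  Module.finrank K
    (↥(homogeneousSubmodule (Fin n) K d) ⧸
      Submodule.comap (homogeneousSubmodule (Fin n) K d).subtype (Submodule.restrictScalars K I))

end Defs

/-- The exponent vectors of degree `d`. -/
noncomputable def expsOfDegree (n d : ℕ) : Finset (Fin n →₀ ℕ) :=
  Finset.finsuppAntidiag Finset.univ d

lemma mem_expsOfDegree {n d : ℕ} {m : Fin n →₀ ℕ} : m ∈ expsOfDegree n d ↔ m.degree = d := by
  simp [expsOfDegree, Finsupp.degree_eq_sum]

/-- The exponent vectors all of whose entries lie strictly below the bounds `b`. -/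
def boundedExps {n : ℕ} (b : Fin n → ℕ∞) : Set (Fin n →₀ ℕ) := {m | ∀ k, (m k : ℕ∞) < b k}

/-- A set of bounded exponent vectors closed under those unit increments that stay bounded. -/
structure IsBoundedUpper {n : ℕ} (b : Fin n → ℕ∞) (Y : Set (Fin n →₀ ℕ)) : Prop where
  subset : Y ⊆ boundedExps b
  add_single : ∀ m ∈ Y, ∀ k, m + Finsupp.single k 1 ∈ boundedExps b → m + Finsupp.single k 1 ∈ Y

/-- The exponent vector with `i`-th entry `p` that agrees with `m` away from `i, j` and has
the same degree as `m` (provided `p ≤ m i + m j`). -/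
noncomputable def rowExp {n : ℕ} (i j : Fin n) (m : Fin n →₀ ℕ) (p : ℕ) : Fin n →₀ ℕ :=
  (m.erase i).erase j + Finsupp.single i p + Finsupp.single j (m i + m j - p)

section Row

variable {n : ℕ} {i j : Fin n}

lemma rowExp_left (hij : i ≠ j) (m : Fin n →₀ ℕ) (p : ℕ) : rowExp i j m p i = p := by
  simp [rowExp, Finsupp.erase_ne hij, hij.symm]

lemma rowExp_right (hij : i ≠ j) (m : Fin n →₀ ℕ) (p : ℕ) :
    rowExp i j m p j = m i + m j - p := by
  simp [rowExp, hij]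

lemma rowExp_of_ne (m : Fin n →₀ ℕ) (p : ℕ) {k : Fin n} (hi : k ≠ i) (hj : k ≠ j) :
    rowExp i j m p k = m k := by
  simp [rowExp, Finsupp.erase_ne hi, Finsupp.erase_ne hj, hi.symm, hj.symm]

lemma rowExp_ext (hij : i ≠ j) {m m' : Fin n →₀ ℕ} {p : ℕ} (h1 : m' i = p)
    (h2 : m' j = m i + m j - p) (h3 : ∀ k, k ≠ i → k ≠ j → m' k = m k) :
    rowExp i j m p = m' := by
  ext k
  rcases eq_or_ne k i with rfl | hi
  · rw [rowExp_left hij, h1]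
  rcases eq_or_ne k j with rfl | hj
  · rw [rowExp_right hij, h2]
  rw [rowExp_of_ne _ _ hi hj, h3 k hi hj]

lemma rowExp_self (hij : i ≠ j) (m : Fin n →₀ ℕ) : rowExp i j m (m i) = m :=
  rowExp_ext hij rfl (by omega) fun _ _ _ => rfl

lemma rowExp_rowExp (hij : i ≠ j) (m : Fin n →₀ ℕ) {p : ℕ} (hp : p ≤ m i + m j) (q : ℕ) :
    rowExp i j (rowExp i j m p) q = rowExp i j m q := by
  refine rowExp_ext hij (rowExp_left hij _ _) ?_ fun k hi hj => ?_
  · rw [rowExp_right hij, rowExp_left hij, rowExp_right hij]; omega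
  · rw [rowExp_of_ne _ _ hi hj, rowExp_of_ne _ _ hi hj]

lemma weight_rowExp (w : Fin n → ℕ) (m : Fin n →₀ ℕ) (p : ℕ) :
    Finsupp.weight w (rowExp i j m p) =
      Finsupp.weight w ((m.erase i).erase j) + p * w i + (m i + m j - p) * w j := by
  simp only [rowExp, map_add, Finsupp.weight_single, smul_eq_mul]

lemma degree_rowExp (hij : i ≠ j) (m : Fin n →₀ ℕ) {p : ℕ} (hp : p ≤ m i + m j) :
    (rowExp i j m p).degree = m.degree := by
  conv_rhs => rw [← rowExp_self hij m]
  simp only [rowExp, map_add, Finsupp.degree_single]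
  omega

lemma rowExp_mem_boundedExps (hij : i ≠ j) {b : Fin n → ℕ∞} {m : Fin n →₀ ℕ} {p : ℕ}
    (hm : ∀ k, k ≠ i → k ≠ j → (m k : ℕ∞) < b k) :
    rowExp i j m p ∈ boundedExps b ↔ (p : ℕ∞) < b i ∧ ((m i + m j - p : ℕ) : ℕ∞) < b j := by
  constructor
  · intro h
    have h1 := h i
    have h2 := h j
    rw [rowExp_left hij] at h1
    rw [rowExp_right hij] at h2
    exact ⟨h1, h2⟩
  · rintro ⟨h1, h2⟩ k
    rcases eq_or_ne k i with rfl | hi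
    · rwa [rowExp_left hij]
    rcases eq_or_ne k j with rfl | hj
    · rwa [rowExp_right hij]
    rw [rowExp_of_ne _ _ hi hj]
    exact hm k hi hj

open Classical in
/-- The possible `i`-th entries of the elements of `Y` in the row of `m`. -/
noncomputable def rowSet (i j : Fin n) (Y : Set (Fin n →₀ ℕ)) (m : Fin n →₀ ℕ) : Finset ℕ :=
  {p ∈ Finset.range (m i + m j + 1) | rowExp i j m p ∈ Y}

lemma mem_rowSet {Y : Set (Fin n →₀ ℕ)} {m : Fin n →₀ ℕ} {p : ℕ} :
    p ∈ rowSet i j Y m ↔ p ≤ m i + m j ∧ rowExp i j m p ∈ Y := by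
  simp [rowSet]

lemma rowSet_rowExp (hij : i ≠ j) (Y : Set (Fin n →₀ ℕ)) (m : Fin n →₀ ℕ) {p : ℕ}
    (hp : p ≤ m i + m j) : rowSet i j Y (rowExp i j m p) = rowSet i j Y m := by
  ext q
  rw [mem_rowSet, mem_rowSet, rowExp_rowExp hij m hp, rowExp_left hij, rowExp_right hij]
  have : p + (m i + m j - p) = m i + m j := by omega
  rw [this]

/-- The compression of `Y` in the directions `i, j`: each row of `Y` is replaced by the bounded
row elements of largest possible `i`-th entry. -/
def compression (b : Fin n → ℕ∞) (i j : Fin n) (Y : Set (Fin n →₀ ℕ)) : Set (Fin n →₀ ℕ) :=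
  {m | m ∈ boundedExps b ∧
    (b i ≤ ((m i + (rowSet i j Y m).card : ℕ) : ℕ∞) ∨ m j < (rowSet i j Y m).card)}

lemma exists_nat_truncation (x : ℕ∞) (T : ℕ) :
    ∃ A : ℕ, ∀ p : ℕ, A ≤ p ↔ x ≤ (p : ℕ∞) ∨ T ≤ p := by
  induction x using ENat.recTopCoe with
  | top => exact ⟨T, fun p => by simp⟩
  | coe x => exact ⟨min x T, fun p => by simp⟩

/-- Growth of top segments in two consecutive degrees of `K[x, y] / (x ^ A, y ^ B)`. -/
lemma segment_growth {A B e p : ℕ} (hAB : A ≤ B) {L L' : Finset ℕ}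
    (hL : ∀ q ∈ L, e + 1 - B ≤ q ∧ q < min A (e + 1))
    (h0 : ∀ q ∈ L, e + 2 - B ≤ q → q < min A (e + 2) → q ∈ L')
    (h1 : ∀ q ∈ L, e + 2 - B ≤ q + 1 → q + 1 < min A (e + 2) → q + 1 ∈ L')
    (hp : p < min A (e + 1)) (hpL : min A (e + 1) ≤ p + L.card) :
    (e + 2 - B ≤ p → min A (e + 2) ≤ p + L'.card) ∧
      (e + 2 - B ≤ p + 1 → min A (e + 2) ≤ p + 1 + L'.card) := by
  by_cases hA : e + 1 < A
  · have hne : L.Nonempty := by rw [← Finset.card_pos]; omega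
    have hsub : insert (L.max' hne + 1) L ⊆ L' := by
      intro q hq
      rcases Finset.mem_insert.1 hq with rfl | hq
      · have := hL _ (L.max'_mem hne)
        exact h1 _ (L.max'_mem hne) (by omega) (by omega)
      · have := hL _ hq
        exact h0 _ hq (by omega) (by omega)
    have hcard := Finset.card_le_card hsub
    rw [Finset.card_insert_of_notMem] at hcard
    · omega
    · intro h
      have := L.le_max' _ h
      omega
  by_cases hB : e + 2 ≤ B
  · have hsub : L ⊆ L' := fun q hq => by
      have := hL _ hq
      exact h0 _ hq (by omega) (by omega)
    have hcard := Finset.card_le_card hsub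
    omega
  by_cases hlo : e + 1 - B ∈ L
  · by_cases hg : ∃ g, e + 1 - B ≤ g ∧ g < A ∧ g ∉ L
    · classical
      have hspec := Nat.find_spec hg
      have hmin := fun q => Nat.find_min (H := hg) (m := q)
      set g := Nat.find hg
      have hne : g ≠ e + 1 - B := fun h => hspec.2.2 (h ▸ hlo)
      have hpred : g - 1 ∈ L := by
        by_contra h
        exact hmin (g - 1) (by omega) ⟨by omega, by omega, h⟩
      have hgL : g ∈ L' := by
        have := h1 _ hpred (by omega) (by omega)
        rwa [show g - 1 + 1 = g by omega] at this
      have hsub : insert g (L.erase (e + 1 - B)) ⊆ L' := by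
        intro q hq
        rcases Finset.mem_insert.1 hq with rfl | hq
        · exact hgL
        · have hq' := Finset.mem_erase.1 hq
          have := hL _ hq'.2
          exact h0 _ hq'.2 (by omega) (by omega)
      have hcard := Finset.card_le_card hsub
      rw [Finset.card_insert_of_notMem
        (fun h => hspec.2.2 (Finset.mem_of_mem_erase h)), Finset.card_erase_of_mem hlo] at hcard
      omega
    · push Not at hg
      have hsub : Finset.Ico (e + 2 - B) A ⊆ L' := fun q hq => by
        have hq' := Finset.mem_Ico.1 hq
        exact h0 q (hg q (by omega) hq'.2) (by omega) (by omega)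
      have hcard := Finset.card_le_card hsub
      rw [Nat.card_Ico] at hcard
      omega
  · have hsub : L ⊆ L' := fun q hq => by
      have := hL _ hq
      have : q ≠ e + 1 - B := fun h => hlo (h ▸ hq)
      exact h0 _ hq (by omega) (by omega)
    have hcard := Finset.card_le_card hsub
    omega

lemma mem_compression_iff {b : Fin n → ℕ∞} {Y : Set (Fin n →₀ ℕ)} {m : Fin n →₀ ℕ} {A T : ℕ}
    (hA : ∀ p : ℕ, A ≤ p ↔ b i ≤ (p : ℕ∞) ∨ T ≤ p) (hT : m i + m j < T)
    (hm : m ∈ boundedExps b) :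
    m ∈ compression b i j Y ↔ min A (m i + m j + 1) ≤ m i + (rowSet i j Y m).card := by
  have h1 := hA (m i + (rowSet i j Y m).card)
  constructor
  · rintro ⟨-, h | h⟩
    · have := h1.2 (Or.inl h)
      omega
    · omega
  · intro h
    refine ⟨hm, ?_⟩
    by_cases hlt : m j < (rowSet i j Y m).card
    · exact Or.inr hlt
    · rcases h1.1 (by omega) with h | h
      · exact Or.inl h
      · omega

lemma mem_Ico_iff_rowExp {b : Fin n → ℕ∞} {A B T e p : ℕ}
    (hA : ∀ p : ℕ, A ≤ p ↔ b i ≤ (p : ℕ∞) ∨ T ≤ p)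
    (hB : ∀ p : ℕ, B ≤ p ↔ b j ≤ (p : ℕ∞) ∨ T ≤ p) (hT : e < T) (hp : p ≤ e) :
    ((p : ℕ∞) < b i ∧ ((e - p : ℕ) : ℕ∞) < b j) ↔ e + 1 - B ≤ p ∧ p < min A (e + 1) := by
  have h1 := hA p
  have h2 := hB (e - p)
  rw [← not_le, ← not_le]
  constructor
  · rintro ⟨h3, h4⟩
    have : ¬ A ≤ p := fun h => (h1.1 h).elim h3 (by omega)
    have : ¬ B ≤ e - p := fun h => (h2.1 h).elim h4 (by omega)
    omega
  · rintro ⟨h3, h4⟩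
    exact ⟨fun h => by have := h1.2 (Or.inl h); omega, fun h => by have := h2.2 (Or.inl h); omega⟩

lemma isBoundedUpper_compression {b : Fin n → ℕ∞} {Y : Set (Fin n →₀ ℕ)}
    (hY : IsBoundedUpper b Y) (hij : i ≠ j) (hb : b i ≤ b j) :
    IsBoundedUpper b (compression b i j Y) := by
  refine ⟨fun m hm => hm.1, fun m hm k hk => ?_⟩
  by_cases hkij : k ≠ i ∧ k ≠ j
  · obtain ⟨hki, hkj⟩ := hkij
    have hi : (m + Finsupp.single k 1 : Fin n →₀ ℕ) i = m i := by simp [Ne.symm hki]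
    have hj : (m + Finsupp.single k 1 : Fin n →₀ ℕ) j = m j := by simp [Ne.symm hkj]
    have hsub : rowSet i j Y m ⊆ rowSet i j Y (m + Finsupp.single k 1) := by
      intro p hp
      rw [mem_rowSet] at hp ⊢
      have hrow : rowExp i j (m + Finsupp.single k 1) p = rowExp i j m p + Finsupp.single k 1 := by
        refine rowExp_ext hij ?_ ?_ fun l hli hlj => ?_
        · simp [rowExp_left hij, hki]
        · simp [rowExp_right hij, hki, hkj]
        · simp [rowExp_of_ne _ _ hli hlj]
      rw [hi, hj]
      refine ⟨hp.1, ?_⟩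
      have hN := (rowExp_mem_boundedExps (p := p) hij
        (fun l _ _ => hk l)).2 (by
          rw [hi, hj]
          exact (rowExp_mem_boundedExps hij (fun l _ _ => hm.1 l)).1 (hY.subset hp.2))
      rw [hrow] at hN ⊢
      exact hY.add_single _ hp.2 k hN
    have hcard := Finset.card_le_card hsub
    refine ⟨hk, ?_⟩
    rw [hi, hj]
    refine hm.2.imp (fun h => h.trans ?_) fun h => by omega
    exact_mod_cast (by omega)
  · set e := m i + m j with he
    obtain ⟨A, hA⟩ := exists_nat_truncation (b i) (e + 3)
    obtain ⟨B, hB⟩ := exists_nat_truncation (b j) (e + 3)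
    have hAB : A ≤ B := (hA B).2 (((hB B).1 le_rfl).imp (fun h => hb.trans h) id)
    set m' := m + Finsupp.single k 1 with hm'
    have hother : ∀ l, l ≠ i → l ≠ j → m' l = m l := by
      intro l hli hlj
      have : k ≠ l := by
        rintro rfl
        exact hkij ⟨hli, hlj⟩
      simp [hm', this.symm]
    have hsum : m' i + m' j = e + 1 := by
      by_cases h : k = i
      · subst h
        simp [hm', hij.symm]; omega
      · have h' : k = j := by tauto
        subst h'
        simp [hm', hij]; omega
    have hmem : ∀ q, q ≤ e + 1 → e + 2 - B ≤ q → q < min A (e + 2) →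
        rowExp i j m' q ∈ boundedExps b := by
      intro q hq h1 h2
      rw [rowExp_mem_boundedExps hij (fun l _ _ => hk l), hsum]
      exact (mem_Ico_iff_rowExp hA hB (by omega) hq).2 ⟨h1, h2⟩
    have hL : ∀ q ∈ rowSet i j Y m, e + 1 - B ≤ q ∧ q < min A (e + 1) := by
      intro q hq
      rw [mem_rowSet] at hq
      refine (mem_Ico_iff_rowExp hA hB (by omega) hq.1).1 ?_
      exact (rowExp_mem_boundedExps hij (fun l _ _ => hm.1 l)).1 (hY.subset hq.2)
    have hstep : ∀ q ∈ rowSet i j Y m, ∀ (q' : ℕ) (l : Fin n), q' ≤ e + 1 →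
        rowExp i j m' q' = rowExp i j m q + Finsupp.single l 1 →
        e + 2 - B ≤ q' → q' < min A (e + 2) → q' ∈ rowSet i j Y m' := by
      intro q hq q' l hq' hrow h1 h2
      rw [mem_rowSet] at hq ⊢
      refine ⟨by omega, ?_⟩
      have := hmem q' hq' h1 h2
      rw [hrow] at this ⊢
      exact hY.add_single _ hq.2 l this
    have hp := (mem_Ico_iff_rowExp (e := e) hA hB (by omega) (show m i ≤ e by omega)).1
      ⟨hm.1 i, by rw [show e - m i = m j by omega]; exact hm.1 j⟩
    have key := segment_growth (p := m i) (L' := rowSet i j Y m') hAB hL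
      (fun q hq => hstep q hq q j (by have := (mem_rowSet.1 hq).1; omega) (by
        have hqe := (mem_rowSet.1 hq).1
        refine rowExp_ext hij ?_ ?_ fun l hli hlj => ?_
        · simp [rowExp_left hij, hij]
        · simp [rowExp_right hij]; omega
        · simp [rowExp_of_ne _ _ hli hlj, hother l hli hlj, hlj]))
      (fun q hq => hstep q hq (q + 1) i (by have := (mem_rowSet.1 hq).1; omega) (by
        have hqe := (mem_rowSet.1 hq).1
        refine rowExp_ext hij ?_ ?_ fun l hli hlj => ?_
        · simp [rowExp_left hij]
        · simp [rowExp_right hij, hij.symm]; omega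
        · simp [rowExp_of_ne _ _ hli hlj, hother l hli hlj, hli]))
      hp.2 ((mem_compression_iff hA (by omega) hm.1).1 hm)
    rw [mem_compression_iff hA (by omega) hk, hsum]
    have hp' := (mem_Ico_iff_rowExp (e := e + 1) hA hB (by omega) (show m' i ≤ e + 1 by omega)).1
      ⟨hk i, by rw [show e + 1 - m' i = m' j by omega]; exact hk j⟩
    by_cases h : k = i
    · have hmi : m' i = m i + 1 := by simp [hm', h]
      rw [hmi] at hp' ⊢
      exact key.2 hp'.1
    · have hmi : m' i = m i := by simp [hm', h]
      rw [hmi] at hp' ⊢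
      exact key.1 hp'.1

lemma exists_rowSet_compression {b : Fin n → ℕ∞} {Y : Set (Fin n →₀ ℕ)} (hY : Y ⊆ boundedExps b)
    (hij : i ≠ j) (m : Fin n →₀ ℕ) :
    ∃ t h : ℕ, rowSet i j (compression b i j Y) m = Finset.Ico t h ∧
      (∀ q ∈ rowSet i j Y m, q < h) ∧ (rowSet i j Y m).card = h - t := by
  rcases (rowSet i j Y m).eq_empty_or_nonempty with hem | ⟨q, hq⟩
  · refine ⟨0, 0, ?_, by simp [hem], by simp [hem]⟩
    rw [Finset.Ico_self, Finset.eq_empty_iff_forall_notMem]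
    intro p hp
    rw [mem_rowSet] at hp
    obtain ⟨hp, hpN, hp'⟩ := hp
    rw [rowSet_rowExp hij _ _ hp, hem] at hp'
    rcases hp' with h | h
    · exact absurd (hpN i) (not_lt.2 (by simpa using h))
    · simp at h
  · set e := m i + m j with he
    obtain ⟨A, hA⟩ := exists_nat_truncation (b i) (e + 3)
    obtain ⟨B, hB⟩ := exists_nat_truncation (b j) (e + 3)
    have hm : ∀ k, k ≠ i → k ≠ j → (m k : ℕ∞) < b k := by
      intro k hi hj
      have := hY (mem_rowSet.1 hq).2 k
      rwa [rowExp_of_ne _ _ hi hj] at this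
    have hmem : ∀ p ≤ e, rowExp i j m p ∈ boundedExps b ↔ e + 1 - B ≤ p ∧ p < min A (e + 1) :=
      fun p hp => (rowExp_mem_boundedExps hij hm).trans (mem_Ico_iff_rowExp hA hB (by omega) hp)
    have hL : ∀ q ∈ rowSet i j Y m, e + 1 - B ≤ q ∧ q < min A (e + 1) := fun q hq =>
      (hmem q (mem_rowSet.1 hq).1).1 (hY (mem_rowSet.1 hq).2)
    have hcard : (rowSet i j Y m).card ≤ min A (e + 1) - (e + 1 - B) := by
      rw [← Nat.card_Ico]
      exact Finset.card_le_card fun q hq => Finset.mem_Ico.2 (hL q hq)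
    refine ⟨min A (e + 1) - (rowSet i j Y m).card, min A (e + 1), ?_, fun q hq => (hL q hq).2,
      by omega⟩
    have := hL q hq
    ext p
    rw [mem_rowSet, Finset.mem_Ico]
    by_cases hp : p ≤ e
    · have hsum : rowExp i j m p i + rowExp i j m p j = e := by
        rw [rowExp_left hij, rowExp_right hij]; omega
      by_cases hN : rowExp i j m p ∈ boundedExps b
      · rw [mem_compression_iff hA (by omega) hN, hsum, rowExp_left hij, rowSet_rowExp hij _ _ hp]
        have := (hmem p hp).1 hN
        omega
      · have h1 : rowExp i j m p ∉ compression b i j Y := fun h => hN h.1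
        rw [hmem p hp] at hN
        simp only [h1, and_false, false_iff]
        omega
    · omega

lemma sum_le_sum_of_eq_Ico {L L' : Finset ℕ} {t h : ℕ} (hL' : L' = Finset.Ico t h)
    (hL : ∀ q ∈ L, q < h) (hcard : L.card = h - t) :
    L.card = L'.card ∧ ∑ q ∈ L, q ≤ ∑ q ∈ L', q ∧ (∑ q ∈ L, q = ∑ q ∈ L', q → L = L') := by
  have hcard' : L.card = L'.card := by rw [hL', Nat.card_Ico, hcard]
  have h1 := Finset.sum_inter_add_sum_sdiff L L' (fun q => q)
  have h2 := Finset.sum_inter_add_sum_sdiff L' L (fun q => q)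
  have h3 : (L \ L').card = (L' \ L).card := Finset.card_sdiff_comm hcard'
  have h4 : ∑ q ∈ L \ L', (q + 1) ≤ (L \ L').card * t := by
    rw [← smul_eq_mul]
    refine Finset.sum_le_card_nsmul _ _ _ fun q hq => ?_
    rw [Finset.mem_sdiff, hL', Finset.mem_Ico] at hq
    have := hL q hq.1
    omega
  have h5 : (L' \ L).card * t ≤ ∑ q ∈ L' \ L, q := by
    rw [← smul_eq_mul]
    refine Finset.card_nsmul_le_sum _ _ _ fun q hq => ?_
    rw [Finset.mem_sdiff, hL', Finset.mem_Ico] at hq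
    omega
  rw [Finset.sum_add_distrib, Finset.sum_const, smul_eq_mul, mul_one] at h4
  rw [Finset.inter_comm] at h2
  rw [h3] at h4
  refine ⟨hcard', by omega, fun h => ?_⟩
  have h6 : (L \ L').card = 0 := by omega
  rw [Finset.card_eq_zero, Finset.sdiff_eq_empty_iff_subset] at h6
  exact Finset.eq_of_subset_of_card_le h6 hcard'.ge

open Classical in
/-- The sum of `g` over the elements of `Y` of degree `d`. -/
noncomputable def degreeSum (g : (Fin n →₀ ℕ) → ℕ) (Y : Set (Fin n →₀ ℕ)) (d : ℕ) : ℕ :=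
  ∑ m ∈ expsOfDegree n d with m ∈ Y, g m

open Classical in
lemma degreeSum_eq_sum_rowSet (hij : i ≠ j) (g : (Fin n →₀ ℕ) → ℕ) (Y : Set (Fin n →₀ ℕ))
    (d : ℕ) :
    degreeSum g Y d = ∑ u ∈ (expsOfDegree n d).image (rowExp i j · 0),
      ∑ p ∈ rowSet i j Y u, g (rowExp i j u p) := by
  rw [degreeSum, ← Finset.sum_fiberwise_of_maps_to (t := (expsOfDegree n d).image (rowExp i j · 0))
    (g := (rowExp i j · 0))
    (fun m hm => Finset.mem_image_of_mem _ (Finset.mem_filter.1 hm).1)]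
  refine Finset.sum_congr rfl fun u hu => ?_
  obtain ⟨v, hv, rfl⟩ := Finset.mem_image.1 hu
  have hrow : ∀ q, rowExp i j (rowExp i j v 0) q = rowExp i j v q := fun q =>
    rowExp_rowExp hij v (Nat.zero_le _) q
  simp only [hrow, rowSet_rowExp hij Y v (Nat.zero_le _)]
  have hfib : ∀ m, rowExp i j m 0 = rowExp i j v 0 →
      (∀ q, rowExp i j v q = rowExp i j m q) ∧ m i + m j = v i + v j := by
    intro m hm
    refine ⟨fun q => by rw [← hrow, ← hm, rowExp_rowExp hij m (Nat.zero_le _)], ?_⟩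
    have := DFunLike.congr_fun hm j
    rwa [rowExp_right hij, rowExp_right hij] at this
  refine Finset.sum_nbij' (fun m => m i) (fun p => rowExp i j v p) ?_ ?_ ?_ ?_ ?_
  · intro m hm
    simp only [Finset.mem_filter] at hm
    obtain ⟨h1, h2⟩ := hfib m hm.2
    rw [mem_rowSet, h1, rowExp_self hij]
    exact ⟨by omega, hm.1.2⟩
  · intro p hp
    rw [mem_rowSet] at hp
    simp only [Finset.mem_filter, mem_expsOfDegree] at hv ⊢
    exact ⟨⟨(degree_rowExp hij v hp.1).trans hv, hp.2⟩, rowExp_rowExp hij v hp.1 0⟩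
  · intro m hm
    simp only [Finset.mem_filter] at hm
    rw [(hfib m hm.2).1, rowExp_self hij]
  · intro p _
    exact rowExp_left hij v p
  · intro m hm
    simp only [Finset.mem_filter] at hm
    rw [(hfib m hm.2).1, rowExp_self hij]

lemma degreeSum_one_compression {b : Fin n → ℕ∞} {Y : Set (Fin n →₀ ℕ)}
    (hY : Y ⊆ boundedExps b) (hij : i ≠ j) (d : ℕ) :
    degreeSum (fun _ => 1) (compression b i j Y) d = degreeSum (fun _ => 1) Y d := by
  rw [degreeSum_eq_sum_rowSet hij, degreeSum_eq_sum_rowSet hij]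
  refine Finset.sum_congr rfl fun u _ => ?_
  obtain ⟨t, h, h1, h2, h3⟩ := exists_rowSet_compression hY hij u
  simpa using (sum_le_sum_of_eq_Ico h1 h2 h3).1.symm

lemma sum_weight_rowExp {w : Fin n → ℕ} (hw : w j ≤ w i) (m : Fin n →₀ ℕ)
    (Y : Set (Fin n →₀ ℕ)) :
    ∑ p ∈ rowSet i j Y m, Finsupp.weight w (rowExp i j m p) =
      (rowSet i j Y m).card * (Finsupp.weight w ((m.erase i).erase j) + (m i + m j) * w j) +
        (w i - w j) * ∑ p ∈ rowSet i j Y m, p := by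
  rw [← smul_eq_mul, ← Finset.sum_const, Finset.mul_sum, ← Finset.sum_add_distrib]
  refine Finset.sum_congr rfl fun p hp => ?_
  rw [weight_rowExp]
  obtain ⟨q, hq⟩ := Nat.exists_eq_add_of_le (mem_rowSet.1 hp).1
  obtain ⟨r, hr⟩ := Nat.exists_eq_add_of_le hw
  rw [hq, hr, Nat.add_sub_cancel_left, Nat.add_sub_cancel_left]
  ring

lemma sum_weight_rowSet_compression {b : Fin n → ℕ∞} {Y : Set (Fin n →₀ ℕ)}
    (hY : Y ⊆ boundedExps b) (hij : i ≠ j) {w : Fin n → ℕ} (hw : w j < w i) (m : Fin n →₀ ℕ) :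
    ∑ p ∈ rowSet i j Y m, Finsupp.weight w (rowExp i j m p) ≤
      ∑ p ∈ rowSet i j (compression b i j Y) m, Finsupp.weight w (rowExp i j m p) ∧
    (∑ p ∈ rowSet i j Y m, Finsupp.weight w (rowExp i j m p) =
      ∑ p ∈ rowSet i j (compression b i j Y) m, Finsupp.weight w (rowExp i j m p) →
      rowSet i j Y m = rowSet i j (compression b i j Y) m) := by
  obtain ⟨t, h, h1, h2, h3⟩ := exists_rowSet_compression hY hij m
  obtain ⟨h4, h5, h6⟩ := sum_le_sum_of_eq_Ico h1 h2 h3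
  rw [sum_weight_rowExp hw.le, sum_weight_rowExp hw.le, h4]
  refine ⟨by gcongr, fun h => h6 ?_⟩
  exact Nat.eq_of_mul_eq_mul_left (by omega) (Nat.add_left_cancel h)

lemma degreeSum_weight_le_compression {b : Fin n → ℕ∞} {Y : Set (Fin n →₀ ℕ)}
    (hY : Y ⊆ boundedExps b) (hij : i ≠ j) {w : Fin n → ℕ} (hw : w j < w i) (d : ℕ) :
    degreeSum (Finsupp.weight w) Y d ≤ degreeSum (Finsupp.weight w) (compression b i j Y) d := by
  rw [degreeSum_eq_sum_rowSet hij, degreeSum_eq_sum_rowSet hij]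
  exact Finset.sum_le_sum fun u _ => (sum_weight_rowSet_compression hY hij hw u).1

lemma compression_eq_self {b : Fin n → ℕ∞} {Y : Set (Fin n →₀ ℕ)}
    (hY : Y ⊆ boundedExps b) (hij : i ≠ j) {w : Fin n → ℕ} (hw : w j < w i)
    (h : ∀ d, degreeSum (Finsupp.weight w) (compression b i j Y) d =
      degreeSum (Finsupp.weight w) Y d) : compression b i j Y = Y := by
  classical
  ext m
  have hd := (h m.degree).symm
  rw [degreeSum_eq_sum_rowSet hij, degreeSum_eq_sum_rowSet hij, Finset.sum_eq_sum_iff_of_le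
    fun u _ => (sum_weight_rowSet_compression hY hij hw u).1] at hd
  have hrow := (sum_weight_rowSet_compression hY hij hw _).2
    (hd _ (Finset.mem_image_of_mem _ (mem_expsOfDegree.2 rfl)))
  rw [rowSet_rowExp hij _ _ (Nat.zero_le _), rowSet_rowExp hij _ _ (Nat.zero_le _)] at hrow
  have hiff := fun Z => mem_rowSet (i := i) (j := j) (Y := Z) (m := m) (p := m i)
  simp only [rowExp_self hij, Nat.le_add_right, true_and] at hiff
  rw [← hiff, ← hrow, hiff]

lemma add_single_mem_of_compression_eq {b : Fin n → ℕ∞} {Y : Set (Fin n →₀ ℕ)} (hij : i ≠ j)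
    (h : compression b i j Y = Y) {m : Fin n →₀ ℕ} (hm : m + Finsupp.single j 1 ∈ Y)
    (hN : m + Finsupp.single i 1 ∈ boundedExps b) : m + Finsupp.single i 1 ∈ Y := by
  have hrow : rowExp i j (m + Finsupp.single j 1) (m i + 1) = m + Finsupp.single i 1 := by
    refine rowExp_ext hij (by simp) ?_ fun k hi hj => ?_
    · simp [hij, hij.symm]; omega
    · simp [hi, hj]
  rw [← h] at hm ⊢
  refine ⟨hN, ?_⟩
  rw [← hrow, rowSet_rowExp hij _ _ (by simp [hij]), hrow]
  have h1 : (m + Finsupp.single j 1 : Fin n →₀ ℕ) i = m i := by simp [hij]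
  have h2 : (m + Finsupp.single j 1 : Fin n →₀ ℕ) j = m j + 1 := by simp
  have h3 : (m + Finsupp.single i 1 : Fin n →₀ ℕ) i = m i + 1 := by simp
  have h4 : (m + Finsupp.single i 1 : Fin n →₀ ℕ) j = m j := by simp [hij.symm]
  rw [h3, h4]
  refine hm.2.imp (fun h => h.trans ?_) fun h => ?_
  · rw [h2] at h
    omega
  · rw [h1]
    exact_mod_cast (by omega)

end Row

open Classical in
lemma degreeSum_le {n : ℕ} (g : (Fin n →₀ ℕ) → ℕ) (Y : Set (Fin n →₀ ℕ)) (d : ℕ) :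
    degreeSum g Y d ≤ ∑ m ∈ expsOfDegree n d, g m :=
  Finset.sum_le_sum_of_subset (Finset.filter_subset _ _)

lemma continuous_degreeSum {n : ℕ} (g : (Fin n →₀ ℕ) → ℕ) (d : ℕ) :
    Continuous fun χ : (Fin n →₀ ℕ) → Bool => degreeSum g {m | χ m = true} d := by
  classical
  simp only [degreeSum, Finset.sum_filter, Set.mem_ofPred_eq]
  refine continuous_finsetSum _ fun m _ => ?_
  exact (continuous_of_discreteTopology (f := fun c : Bool => if c = true then g m else 0)).comp
    (continuous_apply m)

/-- Among the bounded upper sets with prescribed numbers of elements in each degree, there is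
one that cannot be improved with respect to the sums of `g` over all degrees. -/
lemma exists_maximal_degreeSum {n : ℕ} {b : Fin n → ℕ∞} (g : (Fin n →₀ ℕ) → ℕ)
    {Y₀ : Set (Fin n →₀ ℕ)} (hY₀ : IsBoundedUpper b Y₀) :
    ∃ Y, IsBoundedUpper b Y ∧
      (∀ d, degreeSum (fun _ => 1) Y d = degreeSum (fun _ => 1) Y₀ d) ∧
      ∀ Z, IsBoundedUpper b Z →
        (∀ d, degreeSum (fun _ => 1) Z d = degreeSum (fun _ => 1) Y₀ d) →
        (∀ d, degreeSum g Y d ≤ degreeSum g Z d) → ∀ d, degreeSum g Z d = degreeSum g Y d := by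
  classical
  let S : ((Fin n →₀ ℕ) → Bool) → Set (Fin n →₀ ℕ) := fun χ => {m | χ m = true}
  have hS : ∀ Y, S (fun m => decide (m ∈ Y)) = Y := fun Y => by ext; simp [S]
  have hopen : ∀ m, IsClopen {χ : (Fin n →₀ ℕ) → Bool | χ m = true} := fun m =>
    (isClopen_discrete {true}).preimage (continuous_apply m)
  let C : Set ((Fin n →₀ ℕ) → Bool) := {χ | IsBoundedUpper b (S χ) ∧
    ∀ d, degreeSum (fun _ => 1) (S χ) d = degreeSum (fun _ => 1) Y₀ d}
  have hC : IsClosed C := by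
    have h1 : C = (⋂ m, {χ | χ m = true → m ∈ boundedExps b}) ∩
        (⋂ m, ⋂ k, {χ | χ m = true → m + Finsupp.single k 1 ∈ boundedExps b →
          χ (m + Finsupp.single k 1) = true}) ∩
        ⋂ d, {χ | degreeSum (fun _ => 1) (S χ) d = degreeSum (fun _ => 1) Y₀ d} := by
      ext χ
      simp only [C, Set.mem_ofPred_eq, Set.mem_inter_iff, Set.mem_iInter]
      exact and_congr_left fun _ => ⟨fun h => ⟨h.subset, fun m k hm => h.add_single m hm k⟩,
        fun h => ⟨h.1, fun m hm k => h.2 m k hm⟩⟩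
    rw [h1]
    refine IsClosed.inter (IsClosed.inter ?_ ?_) ?_
    · exact isClosed_iInter fun m => isClosed_imp (hopen m).isOpen isClosed_const
    · exact isClosed_iInter fun m => isClosed_iInter fun k =>
        isClosed_imp (hopen m).isOpen (isClosed_imp isOpen_const (hopen _).isClosed)
    · exact isClosed_iInter fun d => isClosed_eq (continuous_degreeSum _ d) continuous_const
  let M : ℕ → ℝ := fun d => 1 + ∑ m ∈ expsOfDegree n d, (g m : ℝ)
  have hM : ∀ d, 0 < M d := fun d => by positivity
  let f : ℕ → ((Fin n →₀ ℕ) → Bool) → ℝ := fun d χ => (1 / 2) ^ d / M d * degreeSum g (S χ) d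
  have hf0 : ∀ d χ, 0 ≤ f d χ := fun d χ => by have := hM d; positivity
  have hf1 : ∀ d χ, f d χ ≤ (1 / 2) ^ d := by
    intro d χ
    have h1 : (degreeSum g (S χ) d : ℝ) ≤ M d := by
      have : (degreeSum g (S χ) d : ℝ) ≤ ∑ m ∈ expsOfDegree n d, (g m : ℝ) := by
        exact_mod_cast degreeSum_le g (S χ) d
      linarith
    calc f d χ ≤ (1 / 2) ^ d / M d * M d := by
          exact mul_le_mul_of_nonneg_left h1 (div_nonneg (by positivity) (hM d).le)
      _ = (1 / 2) ^ d := div_mul_cancel₀ _ (hM d).ne'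
  have hsum : Summable fun d : ℕ => (1 / 2 : ℝ) ^ d := summable_geometric_two
  have hcont : Continuous fun χ => ∑' d, f d χ := by
    refine continuous_tsum (fun d => ?_) hsum fun d χ => ?_
    · exact continuous_const.mul (continuous_of_discreteTopology.comp (continuous_degreeSum g d))
    · rw [Real.norm_of_nonneg (hf0 d χ)]
      exact hf1 d χ
  obtain ⟨χ, hχ, hmax⟩ := hC.isCompact.exists_isMaxOn
    ⟨fun m => decide (m ∈ Y₀), by simp only [C, Set.mem_ofPred_eq, hS]; exact ⟨hY₀, by simp⟩⟩
    hcont.continuousOn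
  refine ⟨S χ, hχ.1, hχ.2, fun Z hZ hZc hle d => ?_⟩
  by_contra hne
  have hZC : (fun m => decide (m ∈ Z)) ∈ C := by
    simp only [C, Set.mem_ofPred_eq, hS]
    exact ⟨hZ, hZc⟩
  refine absurd (isMaxOn_iff.1 hmax _ hZC) (not_le.2 ?_)
  have hsummable : ∀ χ, Summable fun d => f d χ := fun χ =>
    hsum.of_nonneg_of_le (fun d => hf0 d χ) (fun d => hf1 d χ)
  refine Summable.tsum_lt_tsum (i := d) (fun d => ?_) ?_ (hsummable _) (hsummable _)
  · have := hM d
    simp only [f, hS]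
    gcongr
    exact hle d
  · have := hM d
    simp only [f, hS]
    gcongr
    exact lt_of_le_of_ne (hle d) (Ne.symm hne)

/-- A bounded upper set may be replaced by one which has the same number of elements in each
degree and which is stable under those Borel moves that respect the bounds. -/
lemma exists_stable_of_isBoundedUpper {n : ℕ} {b : Fin n → ℕ∞} (hb : Monotone b)
    {Y₀ : Set (Fin n →₀ ℕ)} (hY₀ : IsBoundedUpper b Y₀) :
    ∃ Y, IsBoundedUpper b Y ∧
      (∀ d, degreeSum (fun _ => 1) Y d = degreeSum (fun _ => 1) Y₀ d) ∧
      ∀ (m : Fin n →₀ ℕ) (i j : Fin n), i < j → m + Finsupp.single j 1 ∈ Y →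
        m + Finsupp.single i 1 ∈ boundedExps b → m + Finsupp.single i 1 ∈ Y := by
  let w : Fin n → ℕ := fun k => n - k
  obtain ⟨Y, hY, hc, hmax⟩ := exists_maximal_degreeSum (Finsupp.weight w) hY₀
  refine ⟨Y, hY, hc, fun m i j hij hm hN => ?_⟩
  have hw : w j < w i := by simp only [w]; omega
  refine add_single_mem_of_compression_eq hij.ne ?_ hm hN
  refine compression_eq_self hY.subset hij.ne hw ?_
  exact hmax _ (isBoundedUpper_compression hY hij.ne (hb hij.le))
    (fun d => (degreeSum_one_compression hY.subset hij.ne d).trans (hc d))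
    (degreeSum_weight_le_compression hY.subset hij.ne hw)

lemma IsBoundedUpper.mem_of_le {n : ℕ} {b : Fin n → ℕ∞} {Y : Set (Fin n →₀ ℕ)}
    (hY : IsBoundedUpper b Y) {u w : Fin n →₀ ℕ} (hu : u ∈ Y) (hw : w ∈ boundedExps b)
    (huw : u ≤ w) : w ∈ Y := by
  obtain ⟨c, rfl⟩ := exists_add_of_le huw
  clear huw
  induction hd : c.degree generalizing c with
  | zero =>
    rw [Finsupp.degree_eq_zero_iff] at hd
    simpa [hd] using hu
  | succ d ih =>
    have hc : c ≠ 0 := fun h => by simp [h] at hd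
    obtain ⟨k, hk⟩ := Finsupp.ne_iff.1 hc
    obtain ⟨c', rfl⟩ := exists_add_of_le (Finsupp.single_le_iff.2 (Nat.one_le_iff_ne_zero.2 hk))
    rw [add_comm _ c', ← add_assoc] at hw ⊢
    refine hY.add_single _ (ih c' (fun l => lt_of_le_of_lt ?_ (hw l)) ?_) k hw
    · simp
    · simp only [map_add, Finsupp.degree_single] at hd
      omega

/-- Partial sums of the entries of an exponent vector. -/
def partialSum {n : ℕ} (m : Fin n →₀ ℕ) (k : Fin n) : ℕ := ∑ l ∈ Finset.Iic k, m l

lemma partialSum_add {n : ℕ} (m m' : Fin n →₀ ℕ) (k : Fin n) :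
    partialSum (m + m') k = partialSum m k + partialSum m' k := by
  simp [partialSum, Finset.sum_add_distrib]

lemma partialSum_single {n : ℕ} (i k : Fin n) (p : ℕ) :
    partialSum (Finsupp.single i p) k = if i ≤ k then p else 0 := by
  simp [partialSum, Finsupp.single_apply, Finset.sum_ite_eq]

/-- A set stable under bounded Borel moves is closed under dominance of partial sums. -/
lemma mem_of_partialSum_le {n : ℕ} {b : Fin n → ℕ∞} {Y : Set (Fin n →₀ ℕ)}
    (hY : IsBoundedUpper b Y)
    (hst : ∀ (m : Fin n →₀ ℕ) (i j : Fin n), i < j → m + Finsupp.single j 1 ∈ Y →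
        m + Finsupp.single i 1 ∈ boundedExps b → m + Finsupp.single i 1 ∈ Y)
    {u w : Fin n →₀ ℕ} (hu : u ∈ Y) (hw : w ∈ boundedExps b)
    (huw : ∀ k, partialSum u k ≤ partialSum w k) : w ∈ Y := by
  induction hs : ∑ k, (u k - w k) using Nat.strong_induction_on generalizing u with
  | _ s ih =>
  by_cases hle : u ≤ w
  · exact hY.mem_of_le hu hw hle
  have hex : ∃ j : Fin n, w j < u j := by
    by_contra! h
    exact hle h
  obtain ⟨j, hj, hjmin⟩ : ∃ j : Fin n, w j < u j ∧ ∀ k < j, u k ≤ w k := by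
    obtain ⟨j, hj⟩ := hex
    obtain ⟨j, hj, hmin⟩ := WellFounded.has_min (wellFounded_lt (α := Fin n))
      {j | w j < u j} ⟨j, hj⟩
    exact ⟨j, hj, fun k hk => not_lt.1 fun h => hmin k h hk⟩
  obtain ⟨i, hij, hi⟩ : ∃ i < j, u i < w i := by
    by_contra! h
    refine absurd (huw j) (not_le.2 (Finset.sum_lt_sum (fun k hk => ?_) ⟨j, by simp, hj⟩))
    rcases (Finset.mem_Iic.1 hk).lt_or_eq with h' | rfl
    · exact h k h'
    · exact hj.le
  obtain ⟨m, rfl⟩ : ∃ m, u = m + Finsupp.single j 1 :=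
    ⟨_, (tsub_add_cancel_of_le (Finsupp.single_le_iff.2 (show 1 ≤ u j by omega))).symm⟩
  have hmi : (m + Finsupp.single j 1 : Fin n →₀ ℕ) i = m i := by simp [hij.ne]
  have hmk : ∀ k, (m + Finsupp.single j 1 : Fin n →₀ ℕ) k = m k + if j = k then 1 else 0 :=
    fun k => by simp [Finsupp.single_apply]
  have hmk' : ∀ k, (m + Finsupp.single i 1 : Fin n →₀ ℕ) k = m k + if i = k then 1 else 0 :=
    fun k => by simp [Finsupp.single_apply]
  rw [hmi] at hi
  have hN : m + Finsupp.single i 1 ∈ boundedExps b := by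
    intro k
    rcases eq_or_ne i k with rfl | hk
    · refine lt_of_le_of_lt ?_ (hw i)
      rw [hmk', if_pos rfl]
      exact_mod_cast hi
    · refine lt_of_le_of_lt ?_ (hY.subset hu k)
      rw [hmk', if_neg hk, hmk]
      exact_mod_cast (by omega)
  refine ih _ ?_ (hst m i j hij hu hN) ?_ rfl
  · rw [← hs]
    refine Finset.sum_lt_sum (fun k _ => ?_) ⟨j, Finset.mem_univ _, ?_⟩
    · rw [hmk, hmk']
      rcases eq_or_ne i k with rfl | hk
      · simp; omega
      · simp [hk]; omega
    · rw [hmk] at hj ⊢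
      rw [hmk', if_neg hij.ne]
      simp only [if_true] at hj ⊢
      omega
  · intro k
    have hk := huw k
    rw [partialSum_add, partialSum_single] at hk ⊢
    rcases le_or_gt j k with hjk | hjk
    · rwa [if_pos (hij.le.trans hjk), ← if_pos (c := j ≤ k) (t := 1) (e := 0) hjk]
    · split_ifs with hik
      · have : partialSum m k < partialSum w k := by
          refine Finset.sum_lt_sum (fun l hl => ?_) ⟨i, Finset.mem_Iic.2 hik, hi⟩
          have hlj := (Finset.mem_Iic.1 hl).trans_lt hjk
          have := hjmin l hlj
          rwa [hmk, if_neg hlj.ne'] at this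
        omega
      · rw [if_neg (not_le.2 hjk)] at hk
        exact hk

section Leading

variable {K : Type*} [Field K] {n : ℕ}

open Classical in
/-- The dimension of a space of polynomials is the number of its leading exponents. -/
lemma finrank_eq_card_leadingExps (o : MonomialOrder (Fin n))
    (V : Submodule K (MvPolynomial (Fin n) K)) (s : Finset (Fin n →₀ ℕ))
    (hs : ∀ f ∈ V, f ≠ 0 → o.degree f ∈ s) :
    Module.finrank K V = (s.filter fun m => ∃ f ∈ V, f ≠ 0 ∧ o.degree f = m).card := by
  set L := s.filter fun m => ∃ f ∈ V, f ≠ 0 ∧ o.degree f = m with hL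
  let φ : V →ₗ[K] (L → K) := LinearMap.pi fun l => (lcoeff K l.1).comp V.subtype
  have hφ : Function.Injective φ := by
    rw [← LinearMap.ker_eq_bot, LinearMap.ker_eq_bot']
    rintro ⟨f, hf⟩ h
    by_contra hne
    have hne : f ≠ 0 := fun h => hne (Subtype.ext h)
    have h1 := congr_fun h ⟨o.degree f, Finset.mem_filter.2 ⟨hs f hf hne, f, hf, hne, rfl⟩⟩
    exact o.coeff_degree_ne_zero_iff.2 hne h1
  have : Module.Finite K V := Module.Finite.of_injective φ hφ
  have hchoice : ∀ l : L, ∃ f : V, (f : MvPolynomial (Fin n) K) ≠ 0 ∧ o.degree f.1 = l.1 := by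
    rintro ⟨l, hl⟩
    obtain ⟨f, hf, hne, h⟩ := (Finset.mem_filter.1 hl).2
    exact ⟨⟨f, hf⟩, hne, h⟩
  choose g hg0 hgl using hchoice
  have hind : LinearIndependent K g := by
    rw [Fintype.linearIndependent_iff]
    intro c hc
    by_contra! hex
    obtain ⟨l₀, hl₀⟩ := hex
    obtain ⟨l, hl, hmax⟩ := Finset.exists_max_image ({l | c l ≠ 0} : Finset L)
      (fun l => o.toSyn l.1) ⟨l₀, by simpa using hl₀⟩
    have h1 := congr_arg (fun f : V => coeff l.1 f.1) hc
    simp only [AddSubmonoidClass.coe_finsetSum, coeff_sum, Submodule.coe_smul, coeff_smul,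
      ZeroMemClass.coe_zero, coeff_zero] at h1
    rw [Finset.sum_eq_single l] at h1
    · have h2 := o.coeff_degree_ne_zero_iff.2 (hg0 l)
      rw [hgl] at h2
      exact mul_ne_zero (by simpa using hl) h2 h1
    · intro l' _ hne
      by_cases hcl : c l' = 0
      · rw [hcl, zero_smul]
      · have hlt : o.toSyn l'.1 < o.toSyn l.1 :=
          lt_of_le_of_ne (hmax l' (by simpa using hcl))
            fun h => hne (Subtype.ext (o.toSyn.injective h))
        rw [o.coeff_eq_zero_of_lt (by rwa [hgl]), smul_zero]
    · simp
  refine le_antisymm ?_ ?_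
  · simpa using LinearMap.finrank_le_finrank_of_injective hφ
  · simpa using hind.fintype_card_le_finrank

/-- The leading exponents of the homogeneous elements of an ideal. -/
def leadingExps (I : Ideal (MvPolynomial (Fin n) K)) : Set (Fin n →₀ ℕ) :=
  {m | ∃ f ∈ component I m.degree, f ≠ 0 ∧ MonomialOrder.lex.degree f = m}

lemma mem_component {I : Ideal (MvPolynomial (Fin n) K)} {d : ℕ} {f : MvPolynomial (Fin n) K} :
    f ∈ component I d ↔ f ∈ I ∧ f.IsHomogeneous d := by
  simp [component, Submodule.mem_inf]

lemma degree_lex_degree {f : MvPolynomial (Fin n) K} {d : ℕ} (hf : f.IsHomogeneous d)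
    (h0 : f ≠ 0) : (MonomialOrder.lex.degree f).degree = d := by
  by_contra h
  exact MonomialOrder.lex.coeff_degree_ne_zero_iff.2 h0 (hf.coeff_eq_zero h)

lemma hilb_eq_degreeSum (I : Ideal (MvPolynomial (Fin n) K)) (d : ℕ) :
    hilb I d = degreeSum (fun _ => 1) (leadingExps I) d := by
  classical
  rw [hilb, finrank_eq_card_leadingExps MonomialOrder.lex (component I d) (expsOfDegree n d)
    fun f hf h0 => mem_expsOfDegree.2 (degree_lex_degree (mem_component.1 hf).2 h0)]
  rw [degreeSum, Finset.sum_const, smul_eq_mul, mul_one]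
  congr 1
  refine Finset.filter_congr fun m hm => ?_
  rw [mem_expsOfDegree] at hm
  rw [leadingExps, Set.mem_ofPred_eq, hm]

lemma leadingExps_add_single {I : Ideal (MvPolynomial (Fin n) K)} {m : Fin n →₀ ℕ}
    (hm : m ∈ leadingExps I) (k : Fin n) : m + Finsupp.single k 1 ∈ leadingExps I := by
  obtain ⟨f, hf, h0, hfm⟩ := hm
  rw [mem_component] at hf
  refine ⟨f * X k, mem_component.2 ⟨I.mul_mem_right _ hf.1, ?_⟩, mul_ne_zero h0 (X_ne_zero k), ?_⟩
  · rw [map_add, Finsupp.degree_single]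
    exact hf.2.mul (isHomogeneous_X K k)
  · rw [MonomialOrder.degree_mul h0 (X_ne_zero k), hfm, MonomialOrder.degree_X]

lemma mem_leadingExps_of_monomial_mem {I : Ideal (MvPolynomial (Fin n) K)} {m : Fin n →₀ ℕ}
    (hm : monomial m (1 : K) ∈ I) : m ∈ leadingExps I := by
  classical
  refine ⟨monomial m 1, mem_component.2 ⟨hm, isHomogeneous_monomial _ rfl⟩, by simp, ?_⟩
  simp [MonomialOrder.degree_monomial]

lemma leadingExps_eq_of_mem_iff {J : Ideal (MvPolynomial (Fin n) K)} {Z : Set (Fin n →₀ ℕ)}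
    (hJ : ∀ f, f ∈ J ↔ ∀ m ∈ f.support, m ∈ Z) : leadingExps J = Z := by
  ext m
  constructor
  · rintro ⟨f, hf, h0, rfl⟩
    exact (hJ f).1 (mem_component.1 hf).1 _ (MonomialOrder.lex.degree_mem_support h0)
  · intro hm
    refine mem_leadingExps_of_monomial_mem ((hJ _).2 fun m' hm' => ?_)
    rw [Finset.mem_singleton.1 (support_monomial_subset hm')]
    exact hm

end Leading

lemma degreeSum_one_eq_add {n : ℕ} (X N : Set (Fin n →₀ ℕ)) (d : ℕ) :
    degreeSum (fun _ => 1) X d =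
      degreeSum (fun _ => 1) (X ∩ N) d + degreeSum (fun _ => 1) (X ∩ Nᶜ) d := by
  classical
  simp only [degreeSum, Finset.sum_const, smul_eq_mul, mul_one]
  rw [← Finset.card_filter_add_card_filter_not (fun m => m ∈ N), Finset.filter_filter,
    Finset.filter_filter]
  simp only [Set.mem_inter_iff, Set.mem_compl_iff]

/-- The bounds on the exponents of the monomials outside the pure-powers ideal. -/
def powerBounds {r : ℕ} (n : ℕ) (a : Fin r → ℕ) (k : Fin n) : ℕ∞ :=
  if h : k.1 < r then (a ⟨k, h⟩ : ℕ∞) else ⊤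

lemma monotone_powerBounds {n r : ℕ} {a : Fin r → ℕ} (ha : Monotone a) :
    Monotone (powerBounds n a) := by
  intro k l hkl
  unfold powerBounds
  have hkl' : k.1 ≤ l.1 := hkl
  by_cases hl : l.1 < r
  · rw [dif_pos hl, dif_pos (hkl'.trans_lt hl)]
    exact_mod_cast ha (show (⟨k, hkl'.trans_lt hl⟩ : Fin r) ≤ ⟨l, hl⟩ from hkl')
  · rw [dif_neg hl]
    exact le_top

lemma notMem_boundedExps_powerBounds {n r : ℕ} (hrn : r ≤ n) {a : Fin r → ℕ} {m : Fin n →₀ ℕ} :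
    m ∉ boundedExps (powerBounds n a) ↔ ∃ i : Fin r, a i ≤ m (Fin.castLE hrn i) := by
  simp only [boundedExps, Set.mem_ofPred_eq, not_forall, not_lt]
  constructor
  · rintro ⟨k, hk⟩
    unfold powerBounds at hk
    by_cases h : k.1 < r
    · rw [dif_pos h] at hk
      exact ⟨⟨k, h⟩, by exact_mod_cast hk⟩
    · rw [dif_neg h] at hk
      simp at hk
  · rintro ⟨i, hi⟩
    refine ⟨Fin.castLE hrn i, ?_⟩
    rw [powerBounds, dif_pos (by simp)]
    exact_mod_cast hi

lemma purePowers_eq_span_monomial (K : Type*) [Field K] {n r : ℕ} (hrn : r ≤ n) (a : Fin r → ℕ) :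
    purePowers K hrn a = Ideal.span ((fun m => monomial m (1 : K)) ''
      Set.range fun i : Fin r => Finsupp.single (Fin.castLE hrn i) (a i)) := by
  rw [purePowers, ← Set.range_comp]
  simp [Function.comp_def, X_pow_eq_monomial]

/-- Exponents whose partial sums dominate those of some element of `Y`. -/
def dominating {n : ℕ} (Y : Set (Fin n →₀ ℕ)) : Set (Fin n →₀ ℕ) :=
  {w | ∃ u ∈ Y, ∀ k, partialSum u k ≤ partialSum w k}

lemma dominating_of_le {n : ℕ} {Y : Set (Fin n →₀ ℕ)} {v w : Fin n →₀ ℕ} (hv : v ∈ dominating Y)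
    (hvw : v ≤ w) : w ∈ dominating Y := by
  obtain ⟨u, hu, h⟩ := hv
  exact ⟨u, hu, fun k => (h k).trans (Finset.sum_le_sum fun l _ => hvw l)⟩

lemma isStronglyStable_span_dominating (K : Type*) [Field K] {n : ℕ} (Y : Set (Fin n →₀ ℕ)) :
    IsStronglyStable (Ideal.span ((fun m => monomial m (1 : K)) '' dominating Y)) := by
  classical
  refine ⟨⟨_, rfl⟩, fun m i j hji hm => ?_⟩
  rw [mem_ideal_span_monomial_image] at hm ⊢
  intro w hw
  rw [Finset.mem_singleton.1 (support_monomial_subset hw)]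
  obtain ⟨v, hv, hvm⟩ := hm (m + Finsupp.single i 1) (by simp [support_monomial])
  obtain ⟨u, hu, h⟩ := dominating_of_le hv hvm
  refine ⟨_, ⟨u, hu, fun k => (h k).trans ?_⟩, le_rfl⟩
  rw [partialSum_add, partialSum_add, partialSum_single, partialSum_single]
  gcongr
  split_ifs with h1 h2 <;> simp
  exact h2 (hji.trans h1)

/-- If a homogeneous ideal `I ⊆ K[x_1,…,x_n]` contains the pure-powers ideal of a degree
sequence `a`, then there exists an `a`-spp ideal with the same Hilbert function as `I`. -/
theorem exists_spp_same_hilbert {K : Type*} [Field K] {n r : ℕ} (hrn : r ≤ n)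
    (a : Fin r → ℕ) (hpos : ∀ i, 0 < a i) (hmono : Monotone a)
    (I : Ideal (MvPolynomial (Fin n) K)) (hI : IsHomog I)
    (hPP : purePowers K hrn a ≤ I) :
    ∃ J : Ideal (MvPolynomial (Fin n) K), IsSPP hrn a J ∧ ∀ d : ℕ, hilb J d = hilb I d := by
  set N := boundedExps (powerBounds n a)
  have hI0 : IsBoundedUpper (powerBounds n a) (leadingExps I ∩ N) :=
    ⟨Set.inter_subset_right, fun m hm k hk => ⟨leadingExps_add_single hm.1 k, hk⟩⟩
  have hIN : Nᶜ ⊆ leadingExps I := by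
    intro m hm
    refine mem_leadingExps_of_monomial_mem (hPP ?_)
    obtain ⟨i, hi⟩ := (notMem_boundedExps_powerBounds hrn).1 hm
    rw [purePowers_eq_span_monomial, mem_ideal_span_monomial_image]
    intro w hw
    rw [Finset.mem_singleton.1 (support_monomial_subset hw)]
    exact ⟨_, ⟨i, rfl⟩, Finsupp.single_le_iff.2 hi⟩
  obtain ⟨Y, hY, hcount, hstable⟩ :=
    exists_stable_of_isBoundedUpper (monotone_powerBounds hmono) hI0
  refine ⟨_, ⟨_, isStronglyStable_span_dominating K Y, rfl⟩, fun d => ?_⟩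
  rw [hilb_eq_degreeSum, hilb_eq_degreeSum, leadingExps_eq_of_mem_iff (Z := Y ∪ Nᶜ),
    degreeSum_one_eq_add (leadingExps I) N, degreeSum_one_eq_add (Y ∪ Nᶜ) N, ← hcount,
    Set.inter_eq_right.2 hIN, Set.inter_eq_right.2 Set.subset_union_right,
    Set.union_inter_distrib_right, Set.compl_inter_self, Set.union_empty,
    Set.inter_eq_left.2 hY.subset]
  intro f
  rw [purePowers_eq_span_monomial, ← Ideal.span_union, ← Set.image_union,
    mem_ideal_span_monomial_image]
  refine forall₂_congr fun m _ => ⟨?_, ?_⟩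
  · rintro ⟨v, hv | ⟨i, rfl⟩, hvm⟩
    · by_cases hm : m ∈ N
      · obtain ⟨u, hu, h⟩ := dominating_of_le hv hvm
        exact Or.inl (mem_of_partialSum_le hY hstable hu hm h)
      · exact Or.inr hm
    · exact Or.inr ((notMem_boundedExps_powerBounds hrn).2 ⟨i, Finsupp.single_le_iff.1 hvm⟩)
  · rintro (hm | hm)
    · exact ⟨m, Or.inl ⟨m, hm, fun _ => le_rfl⟩, le_rfl⟩
    · obtain ⟨i, hi⟩ := (notMem_boundedExps_powerBounds hrn).1 hm
      exact ⟨_, Or.inr ⟨i, rfl⟩, Finsupp.single_le_iff.2 hi⟩
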